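/- Let q ∈ (0,1) and φ ∈ ℝ. On ℓ²(ℤ₊), let Z₁₁, Z₂₁, Z₂₂ be the unique bounded operators with Z₁₁e_k = −q⁻¹e^{2iφ}√(1−q^{4k}) e_{k−1} (so Z₁₁e₀ = 0), Z₂₁e_k = q^{2k}e^{iφ}e_k, and Z₂₂e_k = √(1−q^{4k+4}) e_{k+1}. Then this triple is irreducible: every bounded operator on ℓ²(ℤ₊) commuting with Z₁₁, Z₂₁, Z₂₂ and their adjoints is a scalar multiple of the identity. -/

import Mathlib

open ContinuousLinearMap Complex

noncomputable section

/-- `ℓ²`-space over an index type, with complex coefficients. -/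
abbrev L2 (ι : Type) [DecidableEq ι] : Type := lp (fun _ : ι => ℂ) 2

/-- The standard orthonormal basis vectors of `L2 ι`. -/
def e {ι : Type} [DecidableEq ι] (i : ι) : L2 ι := lp.single 2 i 1

/-- A family of bounded operators acts irreducibly if every bounded operator commuting with
all members of the family and with all their adjoints is a scalar multiple of the identity. -/
def IsIrreducibleFamily {H : Type} [NormedAddCommGroup H] [InnerProductSpace ℂ H]
    [CompleteSpace H] (Z : Set (H →L[ℂ] H)) : Prop :=
  ∀ T : H →L[ℂ] H,
    (∀ A ∈ Z, T * A = A * T ∧ T * adjoint A = adjoint A * T) →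
    ∃ c : ℂ, T = c • (1 : H →L[ℂ] H)

theorem L2.clm_ext_e {ι F : Type} [DecidableEq ι] [AddCommMonoid F] [Module ℂ F]
    [TopologicalSpace F] [T2Space F] {A B : L2 ι →L[ℂ] F} (h : ∀ i, A (e i) = B (e i)) :
    A = B := by
  refine lp.ext_continuousLinearMap (by simp) fun i => ?_
  ext
  simpa [e] using h i

theorem e_apply {ι : Type} [DecidableEq ι] (i j : ι) :
    (e i : L2 ι) j = if j = i then 1 else 0 := by
  simp [e, lp.single_apply, Pi.single_apply]

/-- A bounded operator which is diagonal on the standard basis acts coordinatewise. -/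
theorem diagonal_apply {ι : Type} [DecidableEq ι] {D : L2 ι →L[ℂ] L2 ι} {μ : ι → ℂ}
    (hD : ∀ i, D (e i) = μ i • e i) (x : L2 ι) (j : ι) : (D x) j = μ j * x j := by
  have h : (lp.evalCLM ℂ (fun _ : ι => ℂ) 2 j).comp D
      = μ j • lp.evalCLM ℂ (fun _ : ι => ℂ) 2 j := by
    refine L2.clm_ext_e fun i => ?_
    by_cases hij : j = i
    · subst hij; simp [hD, e_apply, lp.evalCLM]
    · simp [hD, e_apply, lp.evalCLM, hij]
  simpa [lp.evalCLM] using congrArg (fun f => f x) h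

/-- An operator commuting with a diagonal operator with distinct eigenvalues is diagonal. -/
theorem apply_e_of_commute_diagonal {ι : Type} [DecidableEq ι] {D T : L2 ι →L[ℂ] L2 ι}
    {μ : ι → ℂ} (hμ : Function.Injective μ) (hD : ∀ i, D (e i) = μ i • e i)
    (hT : T * D = D * T) (i : ι) : T (e i) = (T (e i)) i • e i := by
  have h : T (D (e i)) = D (T (e i)) := congrArg (fun S => S (e i)) hT
  ext j
  by_cases hji : j = i
  · subst hji; simp [e_apply]
  · have hj : μ i * (T (e i)) j = μ j * (T (e i)) j := by
      rw [← diagonal_apply hD, ← h, hD]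
      simp
    have : (T (e i)) j = 0 := by
      by_contra hne
      exact hji (hμ (mul_right_cancel₀ hne hj)).symm
    simp [e_apply, hji, this]

/-- An operator commuting with a diagonal operator with distinct eigenvalues and with a weighted
shift with nonzero weights is scalar. -/
theorem scalar_of_commute_diagonal_shift {D S T : L2 ℕ →L[ℂ] L2 ℕ} {μ w : ℕ → ℂ}
    (hμ : Function.Injective μ) (hw : ∀ k, w k ≠ 0) (hD : ∀ k, D (e k) = μ k • e k)
    (hS : ∀ k, S (e k) = w k • e (k + 1)) (hTD : T * D = D * T) (hTS : T * S = S * T) :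
    ∃ c : ℂ, T = c • (1 : L2 ℕ →L[ℂ] L2 ℕ) := by
  have hT := apply_e_of_commute_diagonal hμ hD hTD
  have step (k : ℕ) : (T (e (k + 1))) (k + 1) = (T (e k)) k := by
    have h : T (S (e k)) = S (T (e k)) := congrArg (fun R => R (e k)) hTS
    rw [hT k, map_smul, hS, map_smul] at h
    have h' := congrArg (fun x : L2 ℕ => x (k + 1)) h
    simp only [lp.coeFn_smul, Pi.smul_apply, smul_eq_mul, e_apply, if_true, mul_one] at h'
    exact mul_left_cancel₀ (hw k) (h'.trans (mul_comm _ _))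
  have const (k : ℕ) : (T (e k)) k = (T (e 0)) 0 := by
    induction k with
    | zero => rfl
    | succ k ih => rw [step, ih]
  refine ⟨(T (e 0)) 0, L2.clm_ext_e fun k => ?_⟩
  rw [hT k, const k]
  rfl

/-- The representation `π⁽³⁾_φ` on `ℓ²(ℤ₊)`, given by
`Z₁₁ e_k = −q⁻¹e^{2iφ}√(1−q^{4k}) e_{k−1}` (the coefficient vanishing at `k = 0`),
`Z₂₁ e_k = q^{2k}e^{iφ} e_k`, `Z₂₂ e_k = √(1−q^{4k+4}) e_{k+1}`, is irreducible. -/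
theorem stmt6 (q : ℝ) (hq : q ∈ Set.Ioo (0 : ℝ) 1) (φ : ℝ)
    (Z11 Z21 Z22 : L2 ℕ →L[ℂ] L2 ℕ)
    (h11 : ∀ k : ℕ, Z11 (e k) =
      (-(q : ℂ)⁻¹ * Complex.exp (2 * φ * Complex.I)
        * ((Real.sqrt (1 - q ^ (4 * k)) : ℝ) : ℂ)) • e (k - 1))
    (h21 : ∀ k : ℕ, Z21 (e k) =
      (((q ^ (2 * k) : ℝ) : ℂ) * Complex.exp (φ * Complex.I)) • e k)
    (h22 : ∀ k : ℕ, Z22 (e k) = ((Real.sqrt (1 - q ^ (4 * k + 4)) : ℝ) : ℂ) • e (k + 1)) :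
    IsIrreducibleFamily {Z11, Z21, Z22} := by
  intro T hT
  obtain ⟨hq0, hq1⟩ := hq
  refine scalar_of_commute_diagonal_shift ?_ ?_ h21 h22 (hT Z21 (by simp)).1 (hT Z22 (by simp)).1
  · intro i j hij
    have h := mul_right_cancel₀ (Complex.exp_ne_zero _) hij
    have h2 := pow_right_injective₀ hq0 hq1.ne (Complex.ofReal_injective h)
    omega
  · intro k
    have h : q ^ (4 * k + 4) < 1 := pow_lt_one₀ hq0.le hq1 (by omega)
    exact Complex.ofReal_ne_zero.2 (Real.sqrt_pos.2 (sub_pos.2 h)).ne'
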